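/- For the natural representation of sl₃(ℂ) on the free Lie algebra L on a, b, c, the space of Lie invariants of degree 9 has dimension 4; in particular Wever's element [[[[a,b],[a,c]],[[a,b],[b,c]]],c] + [[[[b,c],[b,a]],[[b,c],[c,a]]],a] + [[[[c,a],[c,b]],[[c,a],[a,b]]],b] is a nonzero Lie invariant of degree 9. -/

import Mathlib

/-!
Setting: the free Lie algebra `FL` over ℂ on three generators `a < b < c`, with the
simple Lie algebra sl₃(ℂ) of traceless 3×3 complex matrices (standard basis
x₁ = E₁₂, x₂ = E₂₃, x₃ = E₁₃, h₁ = E₁₁−E₂₂, h₂ = E₂₂−E₃₃, y₁ = E₂₁, y₂ = E₃₂,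
y₃ = E₃₁) acting on `FL` by derivations extending its natural representation on the
span of the generators (a, b, c are the standard basis column vectors e₁, e₂, e₃,
acted on by matrix-vector multiplication):  x₁.b = a, x₂.c = b, x₃.c = a, h₁.a = a,
h₁.b = −b, h₂.b = b, h₂.c = −c, y₁.a = b, y₂.b = c, y₃.a = c, and all other actions of
these basis elements on the generators are zero.  The derivations realizing these
actions are determined by their values on the generators, so we quantify over
derivations with the prescribed generator values.
-/

noncomputable section

/-- The free Lie algebra over ℂ on three generators. -/
abbrev FL : Type := FreeLieAlgebra ℂ (Fin 3)

/-- The generator `a`. -/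
def genA : FL := FreeLieAlgebra.of ℂ 0

/-- The generator `b`. -/
def genB : FL := FreeLieAlgebra.of ℂ 1

/-- The generator `c`. -/
def genC : FL := FreeLieAlgebra.of ℂ 2

/-- Interpret a nonassociative word on the generators as a Lie monomial in `FL`. -/
def magmaToLie : FreeMagma (Fin 3) → FL
  | .of i => FreeLieAlgebra.of ℂ i
  | .mul t u => ⁅magmaToLie t, magmaToLie u⁆

/-- The homogeneous component `L_j`: the span of the Lie monomials of degree `j`. -/
def homog (j : ℕ) : Submodule ℂ FL :=
  Submodule.span ℂ (magmaToLie '' {t | t.length = j})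

/-- The weight space `L_j^(w₁,w₂)`: the joint eigenspace of the `h₁`- and `h₂`-actions
on `L_j` with eigenvalues `w₁` and `w₂` respectively. -/
def wtsp2 (H1 H2 : LieDerivation ℂ FL FL) (j : ℕ) (w1 w2 : ℤ) : Submodule ℂ FL :=
  homog j ⊓ Module.End.eigenspace (H1.toLinearMap) (w1 : ℂ) ⊓
    Module.End.eigenspace (H2.toLinearMap) (w2 : ℂ)

/-- The space of Lie invariants of degree `j`: elements of `L_j` annihilated by every
element of sl₃(ℂ), equivalently by the actions of the eight standard basis elements. -/
def invariants3 (X1 X2 X3 H1 H2 Y1 Y2 Y3 : LieDerivation ℂ FL FL) (j : ℕ) :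
    Submodule ℂ FL :=
  homog j ⊓ LinearMap.ker X1.toLinearMap ⊓ LinearMap.ker X2.toLinearMap ⊓
    LinearMap.ker X3.toLinearMap ⊓ LinearMap.ker H1.toLinearMap ⊓
    LinearMap.ker H2.toLinearMap ⊓ LinearMap.ker Y1.toLinearMap ⊓
    LinearMap.ker Y2.toLinearMap ⊓ LinearMap.ker Y3.toLinearMap

/-- The Lie subalgebra of `FL` generated by the invariants of degree `< j`.
An invariant of degree `j` is primitive iff it does not belong to this subalgebra. -/
def lowerInv3 (X1 X2 X3 H1 H2 Y1 Y2 Y3 : LieDerivation ℂ FL FL) (j : ℕ) :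
    LieSubalgebra ℂ FL :=
  LieSubalgebra.lieSpan ℂ FL
    (⋃ i < j, (invariants3 X1 X2 X3 H1 H2 Y1 Y2 Y3 i : Set FL))

/-- `[a,b]` -/
def ab : FL := ⁅genA, genB⁆
/-- `[a,c]` -/
def ac : FL := ⁅genA, genC⁆
/-- `[b,c]` -/
def bc : FL := ⁅genB, genC⁆
/-- `[b,a]` -/
def ba : FL := ⁅genB, genA⁆
/-- `[c,a]` -/
def ca : FL := ⁅genC, genA⁆
/-- `[c,b]` -/
def cb : FL := ⁅genC, genB⁆

/-- Wever's invariant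
`[[[[a,b],[a,c]],[[a,b],[b,c]]],c] + [[[[b,c],[b,a]],[[b,c],[c,a]]],a]
+ [[[[c,a],[c,b]],[[c,a],[a,b]]],b]`. -/
def wever : FL :=
  ⁅⁅⁅ab, ac⁆, ⁅ab, bc⁆⁆, genC⁆ + ⁅⁅⁅bc, ba⁆, ⁅bc, ca⁆⁆, genA⁆
    + ⁅⁅⁅ca, cb⁆, ⁅ca, ab⁆⁆, genB⁆


attribute [local instance] LieRing.ofAssociativeRing

/-- Functions on words. -/
abbrev WF : Type := List (Fin 3) → ℂ

/-- Action of a matrix on functions on words. -/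
def Efun (M : Fin 3 → Fin 3 → ℂ) : List (Fin 3) → WF → ℂ
  | [], _ => 0
  | z :: w, f => Efun M w (fun v => f (z :: v)) + ∑ y, M z y * f (y :: w)

lemma Efun_add (M : Fin 3 → Fin 3 → ℂ) (w : List (Fin 3)) :
    ∀ f g : WF, Efun M w (f + g) = Efun M w f + Efun M w g := by
  induction w with
  | nil => intro f g; simp [Efun]
  | cons z w ih =>
    intro f g
    have := ih (fun v => f (z :: v)) (fun v => g (z :: v))
    simp only [Efun, Pi.add_apply, mul_add, Finset.sum_add_distrib]
    rw [show (fun v => f (z :: v) + g (z :: v))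
      = (fun v => f (z :: v)) + (fun v => g (z :: v)) from rfl, this]
    ring

lemma Efun_smul (M : Fin 3 → Fin 3 → ℂ) (w : List (Fin 3)) :
    ∀ (c : ℂ) (f : WF), Efun M w (c • f) = c * Efun M w f := by
  induction w with
  | nil => intro f g; simp [Efun]
  | cons z w ih =>
    intro c f
    have := ih c (fun v => f (z :: v))
    simp only [Efun, Pi.smul_apply, smul_eq_mul]
    rw [show (fun v => c * f (z :: v)) = c • (fun v => f (z :: v)) from rfl, this, mul_add,
      Finset.mul_sum]
    congr 1
    refine Finset.sum_congr rfl fun y _ => by ring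

/-- `Efun` as a linear map. -/
def EM (M : Fin 3 → Fin 3 → ℂ) : Module.End ℂ WF where
  toFun f w := Efun M w f
  map_add' f g := by ext w; exact Efun_add M w f g
  map_smul' c f := by ext w; exact Efun_smul M w c f

/-- Strip the first letter. -/
def strip (z : Fin 3) : WF →ₗ[ℂ] WF where
  toFun f v := f (z :: v)
  map_add' _ _ := rfl
  map_smul' _ _ := rfl

@[simp] lemma strip_apply (z : Fin 3) (f : WF) (v : List (Fin 3)) : strip z f v = f (z :: v) := rfl

@[simp] lemma EM_nil (M : Fin 3 → Fin 3 → ℂ) (f : WF) : EM M f [] = 0 := rfl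

lemma EM_cons (M : Fin 3 → Fin 3 → ℂ) (f : WF) (z : Fin 3) (w : List (Fin 3)) :
    EM M f (z :: w) = EM M (strip z f) w + ∑ y, M z y * f (y :: w) := rfl

lemma strip_EM (M : Fin 3 → Fin 3 → ℂ) (f : WF) (z : Fin 3) :
    strip z (EM M f) = EM M (strip z f) + ∑ y, M z y • strip y f := by
  ext w
  simp [EM_cons]

lemma EM_comm (M N : Fin 3 → Fin 3 → ℂ) (w : List (Fin 3)) : ∀ f : WF,
    EM M (EM N f) w - EM N (EM M f) w
      = EM (fun i j => ∑ k, (M i k * N k j - N i k * M k j)) f w := by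
  induction w with
  | nil => intro f; simp
  | cons z w ih =>
    intro f
    have := ih (strip z f)
    simp only [EM_cons, strip_EM, map_add, map_sum, map_smul, Pi.add_apply, Finset.sum_apply,
      Pi.smul_apply, smul_eq_mul]
    rw [← this]
    simp only [Fin.sum_univ_three]
    ring

/-- Left multiplication by a letter. -/
def Lm (x : Fin 3) : Module.End ℂ WF where
  toFun f w := match w with
    | [] => 0
    | z :: v => if z = x then f v else 0
  map_add' f g := by
    ext w
    cases w with
    | nil => simp
    | cons z v => by_cases h : z = x <;> simp [h]
  map_smul' c f := by
    ext w
    cases w with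
    | nil => simp
    | cons z v => by_cases h : z = x <;> simp [h]

@[simp] lemma Lm_nil (x : Fin 3) (f : WF) : Lm x f [] = 0 := rfl
@[simp] lemma Lm_cons (x z : Fin 3) (f : WF) (w : List (Fin 3)) :
    Lm x f (z :: w) = if z = x then f w else 0 := rfl

lemma strip_Lm (x z : Fin 3) (f : WF) : strip z (Lm x f) = if z = x then f else 0 := by
  ext w
  by_cases h : z = x <;> simp [h]

/-- Right multiplication by a letter. -/
def Rm (x : Fin 3) (f : WF) : WF := fun w => if w.getLast? = some x then f w.dropLast else 0

/-- The empty word. -/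
def one1 : WF := fun w => if w = [] then 1 else 0

/-- The representation on the tensor algebra by left multiplication. -/
def rho : FL →ₗ⁅ℂ⁆ Module.End ℂ WF := FreeLieAlgebra.lift ℂ Lm

lemma rho_of (x : Fin 3) : rho (FreeLieAlgebra.of ℂ x) = Lm x := by
  simp [rho]

/-- Coefficients of the image in the tensor algebra. -/
def cf : FL →ₗ[ℂ] WF where
  toFun Z := rho Z one1
  map_add' a b := by simp
  map_smul' a b := by simp

lemma cf_apply (Z : FL) : cf Z = rho Z one1 := rfl

lemma rho_lie (P Q : FL) (f : WF) : rho ⁅P, Q⁆ f = rho P (rho Q f) - rho Q (rho P f) := by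
  rw [LieHom.map_lie]; rfl

lemma FL_induction (S : LieSubalgebra ℂ FL) (h : ∀ x, FreeLieAlgebra.of ℂ x ∈ S) (Z : FL) :
    Z ∈ S := by
  let φ : FL →ₗ⁅ℂ⁆ S := FreeLieAlgebra.lift ℂ (fun x => ⟨FreeLieAlgebra.of ℂ x, h x⟩)
  have : S.incl.comp φ = LieHom.id := by
    apply FreeLieAlgebra.hom_ext
    intro x
    simp [φ]
  have h2 := congrArg (fun ψ : FL →ₗ⁅ℂ⁆ FL => ψ Z) this
  simp only [LieHom.comp_apply, LieHom.id_apply] at h2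
  rw [← h2]
  exact (φ Z).2

lemma EM_Lm (M : Fin 3 → Fin 3 → ℂ) (x : Fin 3) (f : WF) :
    EM M (Lm x f) - Lm x (EM M f) = ∑ y, M y x • Lm y f := by
  ext w
  cases w with
  | nil => simp
  | cons z w =>
    simp only [Pi.sub_apply, EM_cons, strip_Lm, Lm_cons, Finset.sum_apply, Pi.smul_apply,
      smul_eq_mul]
    by_cases h : z = x
    · subst h
      simp
    · simp [h]

lemma rho_deriv (X : LieDerivation ℂ FL FL) (M : Fin 3 → Fin 3 → ℂ)
    (hX : ∀ x, X (FreeLieAlgebra.of ℂ x) = ∑ y, M y x • FreeLieAlgebra.of ℂ y) (Z : FL) :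
    ∀ f, rho (X Z) f = EM M (rho Z f) - rho Z (EM M f) := by
  let S : LieSubalgebra ℂ FL :=
    { carrier := {Z | ∀ f, rho (X Z) f = EM M (rho Z f) - rho Z (EM M f)}
      add_mem' := by
        intro a b ha hb f
        simp only [map_add, LinearMap.add_apply, ha f, hb f]
        abel
      zero_mem' := by intro f; simp
      smul_mem' := by
        intro c a ha f
        simp only [map_smul, LinearMap.smul_apply, ha f, smul_sub]
      lie_mem' := by
        intro a b ha hb f
        have ha : ∀ f, rho (X a) f = EM M (rho a f) - rho a (EM M f) := ha
        have hb : ∀ f, rho (X b) f = EM M (rho b f) - rho b (EM M f) := hb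
        simp only [LieDerivation.apply_lie_eq_add, map_add, LinearMap.add_apply, rho_lie, ha, hb,
          map_sub]
        abel }
  refine FL_induction S ?_ Z
  intro x f
  rw [hX, rho_of, EM_Lm]
  simp [rho_of]

lemma EM_one1 (M : Fin 3 → Fin 3 → ℂ) : EM M one1 = 0 := by
  ext w
  cases w with
  | nil => simp
  | cons z w =>
    have : strip z one1 = 0 := by ext v; simp [one1]
    rw [EM_cons, this]
    simp [one1]

lemma cf_deriv (X : LieDerivation ℂ FL FL) (M : Fin 3 → Fin 3 → ℂ)
    (hX : ∀ x, X (FreeLieAlgebra.of ℂ x) = ∑ y, M y x • FreeLieAlgebra.of ℂ y) (Z : FL) :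
    cf (X Z) = EM M (cf Z) := by
  rw [cf_apply, rho_deriv X M hX, EM_one1, map_zero, sub_zero, cf_apply]

/-- The right-normed bracketing (Dynkin) map. -/
def Dy : ℕ → WF →ₗ[ℂ] FL
  | 0 => 0
  | 1 => ∑ z, (LinearMap.proj [z]).smulRight (FreeLieAlgebra.of ℂ z)
  | n + 2 => ∑ z, (LieAlgebra.ad ℂ FL (FreeLieAlgebra.of ℂ z)).comp ((Dy (n + 1)).comp (strip z))

lemma Dy_one (f : WF) : Dy 1 f = ∑ z, f [z] • FreeLieAlgebra.of ℂ z := by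
  simp [Dy]

lemma Dy_succ (n : ℕ) (f : WF) :
    Dy (n + 2) f = ∑ z, ⁅FreeLieAlgebra.of ℂ z, Dy (n + 1) (strip z f)⁆ := by
  simp [Dy]

lemma Dy_Lm (n : ℕ) (x : Fin 3) (f : WF) :
    Dy (n + 2) (Lm x f) = ⁅FreeLieAlgebra.of ℂ x, Dy (n + 1) f⁆ := by
  rw [Dy_succ, Finset.sum_eq_single x]
  · simp [strip_Lm]
  · intro b _ hb
    simp [strip_Lm, hb]
  · simp

lemma length_pos' (t : FreeMagma (Fin 3)) : 0 < t.length := t.length_pos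

lemma Dy_rho (t : FreeMagma (Fin 3)) : ∀ (n : ℕ) (f : WF),
    Dy (n + 1 + t.length) (rho (magmaToLie t) f) = ⁅magmaToLie t, Dy (n + 1) f⁆ := by
  induction t with
  | ih1 x => intro n f; simp only [magmaToLie, rho_of]; exact Dy_Lm n x f
  | ih2 t u iht ihu =>
    intro n f
    have h1 := iht (n + u.length) (rho (magmaToLie u) f)
    have h2 := ihu (n + t.length) (rho (magmaToLie t) f)
    rw [show n + u.length + 1 = n + 1 + u.length by ring, ihu] at h1
    rw [show n + t.length + 1 = n + 1 + t.length by ring, iht] at h2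
    change Dy (n + 1 + (t.length + u.length)) (rho ⁅magmaToLie t, magmaToLie u⁆ f)
      = ⁅⁅magmaToLie t, magmaToLie u⁆, _⁆
    rw [rho_lie, map_sub, show n + 1 + (t.length + u.length) = n + 1 + u.length + t.length by ring,
      h1, show n + 1 + u.length + t.length = n + 1 + t.length + u.length by ring, h2, lie_lie]

lemma Dy_cf_magma (t : FreeMagma (Fin 3)) :
    Dy t.length (cf (magmaToLie t)) = (t.length : ℂ) • magmaToLie t := by
  induction t with
  | ih1 x =>
    simp only [magmaToLie, cf_apply, rho_of]
    change Dy 1 _ = ((1 : ℕ) : ℂ) • _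
    rw [Dy_one]
    simp [one1]
  | ih2 t u iht ihu =>
    change Dy (t.length + u.length) (rho ⁅magmaToLie t, magmaToLie u⁆ one1)
      = ((t.length + u.length : ℕ) : ℂ) • ⁅magmaToLie t, magmaToLie u⁆
    obtain ⟨m, hm⟩ : ∃ m, t.length = m + 1 := ⟨t.length - 1, by have := t.length_pos; omega⟩
    obtain ⟨n, hn⟩ : ∃ m, u.length = m + 1 := ⟨u.length - 1, by have := u.length_pos; omega⟩
    have h1 := Dy_rho t n (cf (magmaToLie u))
    have h2 := Dy_rho u m (cf (magmaToLie t))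
    rw [← hn, ihu] at h1
    rw [← hm, iht] at h2
    rw [rho_lie, map_sub, ← cf_apply, ← cf_apply, h2, add_comm, h1, ← lie_skew (magmaToLie u)]
    simp only [lie_smul, Nat.cast_add, add_smul, smul_lie]
    abel

lemma Dy_cf (n : ℕ) (Z : FL) (hZ : Z ∈ homog n) : Dy n (cf Z) = (n : ℂ) • Z := by
  unfold homog at hZ
  induction hZ using Submodule.span_induction with
  | mem x hx =>
    obtain ⟨t, ht, rfl⟩ := hx
    rw [← (ht : t.length = n)]
    exact Dy_cf_magma t
  | zero => simp
  | add x y _ _ hx hy => simp [hx, hy]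
  | smul c x _ hx => rw [map_smul, map_smul, hx, smul_comm]

lemma Dy_mem (n : ℕ) : ∀ f : WF, Dy (n + 1) f ∈ homog (n + 1) := by
  induction n with
  | zero =>
    intro f
    rw [Dy_one]
    refine Submodule.sum_mem _ fun z _ => Submodule.smul_mem _ _ (Submodule.subset_span ?_)
    exact ⟨.of z, rfl, rfl⟩
  | succ n ih =>
    intro f
    rw [Dy_succ]
    refine Submodule.sum_mem _ fun z _ => ?_
    have := ih (strip z f)
    generalize Dy (n + 1) (strip z f) = Y at this
    unfold homog at this
    induction this using Submodule.span_induction with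
    | mem x hx =>
      obtain ⟨t, ht, rfl⟩ := hx
      refine Submodule.subset_span ⟨.mul (.of z) t, ?_, rfl⟩
      change 1 + t.length = _
      rw [(ht : t.length = n + 1)]; ring
    | zero => simp
    | add x y _ _ hx hy => rw [lie_add]; exact Submodule.add_mem _ hx hy
    | smul c x _ hx => rw [lie_smul]; exact Submodule.smul_mem _ _ hx

lemma deriv_Dy (X : LieDerivation ℂ FL FL) (M : Fin 3 → Fin 3 → ℂ)
    (hX : ∀ x, X (FreeLieAlgebra.of ℂ x) = ∑ y, M y x • FreeLieAlgebra.of ℂ y) (n : ℕ) :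
    ∀ f : WF, X (Dy (n + 1) f) = Dy (n + 1) (EM M f) := by
  induction n with
  | zero =>
    intro f
    rw [Dy_one, Dy_one]
    simp only [map_add, map_smul, hX, EM_cons, EM_nil, zero_add, Fin.sum_univ_three]
    module
  | succ n ih =>
    intro f
    rw [Dy_succ, Dy_succ]
    simp only [LieDerivation.apply_lie_eq_add, ih, hX, strip_EM, map_add, map_smul,
      Fin.sum_univ_three, lie_add, add_lie, smul_lie, lie_smul]
    module

/-- support in length `n` -/
lemma rho_length (t : FreeMagma (Fin 3)) : ∀ (n : ℕ) (f : WF), (∀ w, w.length ≠ n → f w = 0) →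
    ∀ w, w.length ≠ n + t.length → rho (magmaToLie t) f w = 0 := by
  induction t with
  | ih1 x =>
    intro n f hf w hw
    simp only [magmaToLie, rho_of]
    cases w with
    | nil => simp
    | cons z w =>
      rw [Lm_cons, hf w]
      · simp
      · intro h; apply hw; simp [h]
  | ih2 t u iht ihu =>
    intro n f hf w hw
    have h : w.length ≠ n + (t.length + u.length) := hw
    simp only [magmaToLie, rho_lie, Pi.sub_apply]
    rw [iht _ _ (ihu _ _ hf) w (by omega), ihu _ _ (iht _ _ hf) w (by omega), sub_zero]

lemma cf_length (n : ℕ) (Z : FL) (hZ : Z ∈ homog n) (w : List (Fin 3)) (hw : w.length ≠ n) :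
    cf Z w = 0 := by
  unfold homog at hZ
  induction hZ using Submodule.span_induction with
  | mem x hx =>
    obtain ⟨t, ht, rfl⟩ := hx
    have ht : t.length = n := ht
    refine rho_length t 0 one1 ?_ w (by omega)
    intro w hw
    have : w ≠ [] := by rintro rfl; exact hw rfl
    simp [one1, this]
  | zero => simp
  | add x y _ _ hx hy => simp [hx, hy]
  | smul c x _ hx => simp [hx]

lemma Rm_add (x : Fin 3) (f g : WF) : Rm x (f + g) = Rm x f + Rm x g := by
  ext w
  by_cases h : w.getLast? = some x <;> simp [Rm, h]

lemma Rm_smul (x : Fin 3) (c : ℂ) (f : WF) : Rm x (c • f) = c • Rm x f := by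
  ext w
  by_cases h : w.getLast? = some x <;> simp [Rm, h]

lemma Rm_Lm (x z : Fin 3) (f : WF) : Rm x (Lm z f) = Lm z (Rm x f) := by
  ext w
  match w with
  | [] => simp [Rm]
  | [y] => simp [Rm]
  | y :: y' :: w =>
    simp only [Rm, Lm_cons, List.getLast?_cons_cons, List.dropLast_cons_cons]
    split_ifs <;> rfl

lemma rho_Rm (x : Fin 3) (Z : FL) : ∀ f, rho Z (Rm x f) = Rm x (rho Z f) := by
  let S : LieSubalgebra ℂ FL :=
    { carrier := {Z | ∀ f, rho Z (Rm x f) = Rm x (rho Z f)}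
      add_mem' := by
        intro a b ha hb f
        simp only [map_add, LinearMap.add_apply, ha f, hb f, Rm_add]
      zero_mem' := by intro f; ext w; simp [Rm]
      smul_mem' := by
        intro c a ha f
        simp only [map_smul, LinearMap.smul_apply, ha f, Rm_smul]
      lie_mem' := by
        intro a b ha hb f
        have ha : ∀ f, rho a (Rm x f) = Rm x (rho a f) := ha
        have hb : ∀ f, rho b (Rm x f) = Rm x (rho b f) := hb
        simp only [rho_lie, ha, hb]
        rw [sub_eq_add_neg, sub_eq_add_neg, ← neg_one_smul ℂ (Rm x _), ← Rm_smul, ← Rm_add,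
          neg_one_smul] }
  refine FL_induction S ?_ Z
  intro z f
  rw [rho_of, Rm_Lm]

lemma cf_lie (z : Fin 3) (Z : FL) :
    cf ⁅FreeLieAlgebra.of ℂ z, Z⁆ = Lm z (cf Z) - Rm z (cf Z) := by
  rw [cf_apply, rho_lie, rho_of, cf_apply, ← rho_Rm]
  congr 2
  ext w
  match w with
  | [] => simp [Rm]
  | [y] => simp [Rm, one1]
  | y :: y' :: w => simp [Rm, one1]

/-- Evaluation of the Dynkin operator. -/
def dyn {R : Type} [CommRing R] : ℕ → (List (Fin 3) → R) → List (Fin 3) → R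
  | 0, f, w => f w
  | n + 1, f, w => match w with
    | [] => 0
    | x :: v => dyn n (fun u => f (x :: u)) v
      - dyn n (fun u => f ((x :: v).getLast (by simp) :: u)) (x :: v).dropLast

lemma cf_Dy (n : ℕ) : ∀ (f : WF) (w : List (Fin 3)), w.length = n + 1 →
    cf (Dy (n + 1) f) w = dyn n f w := by
  induction n with
  | zero =>
    intro f w hw
    obtain ⟨z, rfl⟩ := List.length_eq_one_iff.mp hw
    rw [Dy_one]
    simp [cf_apply, rho_of, one1, dyn]
  | succ n ih =>
    intro f w hw
    match w, hw with
    | x :: v, hw =>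
      have hv : v.length = n + 1 := by simpa using hw
      rw [Dy_succ]
      simp only [map_sum, cf_lie, Finset.sum_apply, Pi.sub_apply, Finset.sum_sub_distrib, dyn]
      congr 1
      · simp only [Lm_cons]
        rw [Finset.sum_ite_eq]
        simp only [Finset.mem_univ, if_true]
        exact ih _ _ hv
      · simp only [Rm, List.getLast?_eq_some_getLast (List.cons_ne_nil x v), Option.some.injEq]
        rw [Finset.sum_ite_eq]
        simp only [Finset.mem_univ, if_true]
        exact ih _ _ (by simp [hv])

/-- Matrix units. -/
def U (x y : Fin 3) : Fin 3 → Fin 3 → ℂ := fun i j => if i = x ∧ j = y then 1 else 0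

lemma EM_U_cons (x y z : Fin 3) (f : WF) (w : List (Fin 3)) :
    EM (U x y) f (z :: w) = EM (U x y) (strip z f) w + if z = x then f (y :: w) else 0 := by
  rw [EM_cons]
  congr 1
  by_cases h : z = x <;> simp [U, h]

lemma EM_diag (d : Fin 3 → ℂ) (w : List (Fin 3)) : ∀ f : WF,
    EM (fun i j => if i = j then d i else 0) f w = (w.map d).sum * f w := by
  induction w with
  | nil => intro f; simp
  | cons z w ih =>
    intro f
    rw [EM_cons, ih]
    simp
    ring

lemma sum_diff (x y : Fin 3) (hxy : x ≠ y) (w : List (Fin 3)) :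
    (w.map (fun i => if i = x then (1 : ℂ) else if i = y then -1 else 0)).sum
      = (w.count x : ℂ) - w.count y := by
  induction w with
  | nil => simp
  | cons z w ih =>
    simp only [List.map_cons, List.sum_cons, ih, List.count_cons]
    by_cases h1 : z = x
    · subst h1
      simp [hxy]; ring
    · by_cases h2 : z = y
      · subst h2
        simp [h1]; ring
      · simp [h1, h2]

lemma EM_H (x y : Fin 3) (hxy : x ≠ y) (f : WF) (w : List (Fin 3)) :
    EM (U x y) (EM (U y x) f) w - EM (U y x) (EM (U x y) f) w
      = ((w.count x : ℂ) - w.count y) * f w := by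
  have hm : (fun i j => ∑ k, (U x y i k * U y x k j - U y x i k * U x y k j))
      = (fun i j => if i = j then (if i = x then (1 : ℂ) else if i = y then -1 else 0) else 0) := by
    funext i j
    revert hxy
    fin_cases x <;> fin_cases y <;> fin_cases i <;> fin_cases j <;> simp [U, Fin.sum_univ_three]
  rw [EM_comm, hm, EM_diag, sum_diff x y hxy]

lemma EM_U_supp (x y : Fin 3) (hxy : x ≠ y) (w : List (Fin 3)) : ∀ h : WF,
    EM (U y x) h w ≠ 0 → ∃ w', h w' ≠ 0 ∧ w'.count x = w.count x + 1 ∧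
      w.count y = w'.count y + 1 := by
  induction w with
  | nil => intro h hw; simp at hw
  | cons z w ih =>
    intro h hw
    rw [EM_U_cons] at hw
    by_cases h1 : EM (U y x) (strip z h) w = 0
    · rw [h1, zero_add] at hw
      by_cases h2 : z = y
      · subst h2
        refine ⟨x :: w, by simpa using hw, ?_, ?_⟩
        · simp [Ne.symm hxy]
        · simp [hxy]
      · simp [h2] at hw
    · obtain ⟨w', h1, h2, h3⟩ := ih _ h1
      refine ⟨z :: w', h1, ?_, ?_⟩ <;> simp only [List.count_cons] <;> omega

lemma sl2_zero (x y : Fin 3) (hxy : x ≠ y) (p q : ℕ) (hpq : p < q) (f : WF)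
    (hs : ∀ w, f w ≠ 0 → w.count x = p ∧ w.count y = q) (hX : EM (U x y) f = 0) : f = 0 := by
  have supp : ∀ (k : ℕ) (w : List (Fin 3)), ((EM (U y x)) ^ k) f w ≠ 0 → w.count x + k = p ∧ w.count y = q + k := by
    intro k
    induction k with
    | zero => intro w hw; exact hs w hw
    | succ k ih =>
      intro w hw
      rw [pow_succ', Module.End.mul_apply] at hw
      obtain ⟨w', h1, h2, h3⟩ := EM_U_supp x y hxy w _ hw
      obtain ⟨h4, h5⟩ := ih w' h1
      omega
  have key : ∀ k : ℕ, EM (U x y) (((EM (U y x)) ^ (k + 1)) f)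
      = (((k : ℂ) + 1) * ((p : ℂ) - q - k)) • ((EM (U y x)) ^ k) f := by
    intro k
    induction k with
    | zero =>
      ext w
      have := EM_H x y hxy f w
      rw [hX, map_zero, Pi.zero_apply, sub_zero] at this
      simp only [zero_add, pow_one, pow_zero, Pi.smul_apply, this, smul_eq_mul, Nat.cast_zero,
        Module.End.one_apply]
      by_cases hf : f w = 0
      · simp [hf]
      · obtain ⟨h1, h2⟩ := hs w hf
        rw [h1, h2]; ring
    | succ k ih =>
      ext w
      have := EM_H x y hxy (((EM (U y x)) ^ (k + 1)) f) w
      rw [ih, map_smul, ← Module.End.mul_apply (EM (U y x)) (EM (U y x) ^ k), ← pow_succ',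
        ← Module.End.mul_apply (EM (U y x)) (EM (U y x) ^ (k + 1)), ← pow_succ',
        sub_eq_iff_eq_add] at this
      rw [this]
      simp only [Pi.smul_apply, smul_eq_mul]
      by_cases hf : ((EM (U y x)) ^ (k + 1)) f w = 0
      · simp [hf]
      · obtain ⟨h1, h2⟩ := supp _ w hf
        have h1 : (w.count x : ℂ) = p - (k + 1) := by rw [← h1]; push_cast; ring
        rw [h1, h2]; push_cast; ring
  have top : ((EM (U y x)) ^ (p + 1)) f = 0 := by
    ext w
    by_contra h
    have := (supp _ w h).1
    omega
  have desc : ∀ k : ℕ, ((EM (U y x)) ^ k) f = 0 → f = 0 := by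
    intro k
    induction k with
    | zero => intro h; simpa using h
    | succ k ih =>
      intro h
      apply ih
      have := key k
      rw [h, map_zero] at this
      rcases smul_eq_zero.mp this.symm with h0 | h0
      · exfalso
        rcases mul_eq_zero.mp h0 with h1 | h1
        · exact Nat.cast_add_one_ne_zero k h1
        · have : ((p : ℕ) : ℂ) = ((q + k : ℕ) : ℂ) := by push_cast; linear_combination h1
          have := Nat.cast_injective this
          omega
      · exact h0
  exact desc _ top

/-- All suffixes have dominant weight. -/
def lat : List (Fin 3) → Bool
  | [] => true
  | z :: w => (Nat.ble ((z :: w).count 1) ((z :: w).count 0) &&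
      Nat.ble ((z :: w).count 2) ((z :: w).count 1)) && lat w

lemma length_count (w : List (Fin 3)) : w.count 0 + w.count 1 + w.count 2 = w.length := by
  induction w with
  | nil => rfl
  | cons z w ih =>
    simp only [List.count_cons, List.length_cons]
    fin_cases z <;> simp <;> omega

lemma hw_zero (n : ℕ) : ∀ (f : WF) (a b c : ℕ), a + b + c = n →
    (∀ w, f w ≠ 0 → w.count 0 = a ∧ w.count 1 = b ∧ w.count 2 = c) →
    EM (U 0 1) f = 0 → EM (U 1 2) f = 0 → (∀ w, lat w = true → f w = 0) → f = 0 := by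
  induction n with
  | zero =>
    intro f a b c hn hs _ _ hl
    ext w
    by_contra h
    have h1 := hs w h
    have h2 := length_count w
    have : w = [] := List.length_eq_zero_iff.mp (by omega)
    subst this
    exact h (hl _ rfl)
  | succ n ih =>
    intro f a b c hn hs hX1 hX2 hl
    by_cases hab : b ≤ a
    swap
    · exact sl2_zero 0 1 (by decide) a b (by omega) f (fun w hw => ⟨(hs w hw).1, (hs w hw).2.1⟩) hX1
    by_cases hbc : c ≤ b
    swap
    · exact sl2_zero 1 2 (by decide) b c (by omega) f (fun w hw => (hs w hw).2) hX2
    have hlat : ∀ z w, lat w = true → f (z :: w) = 0 := by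
      intro z w hw
      by_contra h
      have h1 := hs _ h
      refine h (hl _ ?_)
      simp only [lat, h1.1, h1.2.1, h1.2.2, hw, Bool.and_true, Bool.and_eq_true, Nat.ble_eq]
      exact ⟨hab, hbc⟩
    have h2 : strip 2 f = 0 := by
      by_cases hc : c = 0
      · ext w
        by_contra h
        have := hs _ h
        simp [hc] at this
      refine ih _ a b (c - 1) (by omega) ?_ ?_ ?_ (hlat 2)
      · intro w hw
        have := hs _ hw
        simp at this
        omega
      · ext w
        have := congrFun hX1 (2 :: w)
        rw [EM_U_cons] at this
        simpa using this
      · ext w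
        have := congrFun hX2 (2 :: w)
        rw [EM_U_cons] at this
        simpa using this
    have h1 : strip 1 f = 0 := by
      by_cases hc : b = 0
      · ext w
        by_contra h
        have := hs _ h
        simp [hc] at this
      refine ih _ a (b - 1) c (by omega) ?_ ?_ ?_ (hlat 1)
      · intro w hw
        have := hs _ hw
        simp at this
        omega
      · ext w
        have := congrFun hX1 (1 :: w)
        rw [EM_U_cons] at this
        simpa using this
      · ext w
        have := congrFun hX2 (1 :: w)
        rw [EM_U_cons] at this
        have h3 : f (2 :: w) = 0 := congrFun h2 w
        simpa [h3] using this
    have h0 : strip 0 f = 0 := by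
      by_cases hc : a = 0
      · ext w
        by_contra h
        have := hs _ h
        simp [hc] at this
      refine ih _ (a - 1) b c (by omega) ?_ ?_ ?_ (hlat 0)
      · intro w hw
        have := hs _ hw
        simp at this
        omega
      · ext w
        have := congrFun hX1 (0 :: w)
        rw [EM_U_cons] at this
        have h3 : f (1 :: w) = 0 := congrFun h1 w
        simpa [h3] using this
      · ext w
        have := congrFun hX2 (0 :: w)
        rw [EM_U_cons] at this
        simpa using this
    ext w
    match w with
    | [] => exact hl _ rfl
    | z :: w =>
      fin_cases z
      · exact congrFun h0 w
      · exact congrFun h1 w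
      · exact congrFun h2 w

/-- Lattice words of content (3,3,3). -/
def usL : List (List (Fin 3)) :=
  [[2, 1, 0, 2, 1, 0, 2, 1, 0],
   [2, 1, 0, 2, 1, 2, 0, 1, 0],
   [2, 1, 0, 2, 1, 2, 1, 0, 0],
   [2, 1, 0, 2, 2, 1, 0, 1, 0],
   [2, 1, 0, 2, 2, 1, 1, 0, 0],
   [2, 1, 2, 0, 1, 0, 2, 1, 0],
   [2, 1, 2, 0, 1, 2, 0, 1, 0],
   [2, 1, 2, 0, 1, 2, 1, 0, 0],
   [2, 1, 2, 0, 2, 1, 0, 1, 0],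
   [2, 1, 2, 0, 2, 1, 1, 0, 0],
   [2, 1, 2, 1, 0, 0, 2, 1, 0],
   [2, 1, 2, 1, 0, 2, 0, 1, 0],
   [2, 1, 2, 1, 0, 2, 1, 0, 0],
   [2, 1, 2, 1, 2, 0, 0, 1, 0],
   [2, 1, 2, 1, 2, 0, 1, 0, 0],
   [2, 1, 2, 1, 2, 1, 0, 0, 0],
   [2, 1, 2, 2, 0, 1, 0, 1, 0],
   [2, 1, 2, 2, 0, 1, 1, 0, 0],
   [2, 1, 2, 2, 1, 0, 0, 1, 0],
   [2, 1, 2, 2, 1, 0, 1, 0, 0],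
   [2, 1, 2, 2, 1, 1, 0, 0, 0],
   [2, 2, 1, 0, 1, 0, 2, 1, 0],
   [2, 2, 1, 0, 1, 2, 0, 1, 0],
   [2, 2, 1, 0, 1, 2, 1, 0, 0],
   [2, 2, 1, 0, 2, 1, 0, 1, 0],
   [2, 2, 1, 0, 2, 1, 1, 0, 0],
   [2, 2, 1, 1, 0, 0, 2, 1, 0],
   [2, 2, 1, 1, 0, 2, 0, 1, 0],
   [2, 2, 1, 1, 0, 2, 1, 0, 0],
   [2, 2, 1, 1, 2, 0, 0, 1, 0],
   [2, 2, 1, 1, 2, 0, 1, 0, 0],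
   [2, 2, 1, 1, 2, 1, 0, 0, 0],
   [2, 2, 1, 2, 0, 1, 0, 1, 0],
   [2, 2, 1, 2, 0, 1, 1, 0, 0],
   [2, 2, 1, 2, 1, 0, 0, 1, 0],
   [2, 2, 1, 2, 1, 0, 1, 0, 0],
   [2, 2, 1, 2, 1, 1, 0, 0, 0],
   [2, 2, 2, 1, 0, 1, 0, 1, 0],
   [2, 2, 2, 1, 0, 1, 1, 0, 0],
   [2, 2, 2, 1, 1, 0, 0, 1, 0],
   [2, 2, 2, 1, 1, 0, 1, 0, 0],
   [2, 2, 2, 1, 1, 1, 0, 0, 0]]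

/-- Coordinates. -/
def AL : List (List ℤ) :=
  [[0, 0, 0, 0],
   [0, 0, 0, 0],
   [0, 0, 0, 0],
   [0, 0, 0, 0],
   [0, 0, 0, 0],
   [0, 0, 0, 0],
   [4, 0, 0, 0],
   [2, 0, 0, 0],
   [2, 0, 0, 0],
   [1, 0, 0, 0],
   [0, 0, 0, 0],
   [0, 4, 0, 0],
   [0, 2, 0, 0],
   [-2, 6, 0, 0],
   [-1, 3, 0, 0],
   [0, 1, 0, 0],
   [0, 2, 0, 0],
   [0, 1, 0, 0],
   [0, 0, 2, 0],
   [0, 0, 1, 0],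
   [-2, 1, 1, 0],
   [0, 0, 0, 0],
   [0, 0, 0, 4],
   [0, 0, 0, 2],
   [0, 0, 0, 2],
   [0, 0, 0, 1],
   [0, 0, 0, 0],
   [-12, 4, 0, 4],
   [-6, 2, 0, 2],
   [-18, 6, 0, 4],
   [-9, 3, 0, 2],
   [-3, 1, 0, 1],
   [-6, 2, 0, 2],
   [-3, 1, 0, 1],
   [-10, -6, 4, 2],
   [-5, -3, 2, 1],
   [-8, -2, 2, 0],
   [-4, 0, 0, 0],
   [-2, 0, 0, 0],
   [-12, -8, 4, -4],
   [-6, -4, 2, -2],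
   [-9, -4, 2, 0]]

/-- Values of the four basis invariants at the lattice words. -/
def CL : List (List ℤ) :=
  [[0, 0, 0, 0],
   [0, 2, 6, 4],
   [-1, -1, -3, -4],
   [-1, -3, -7, -2],
   [1, 1, 2, 1],
   [0, -2, -6, -4],
   [0, 0, 0, 0],
   [1, 1, 3, 0],
   [1, 1, 1, 0],
   [-1, -1, -2, 0],
   [1, 3, 7, 2],
   [-1, -1, -1, 0],
   [0, -1, -4, 1],
   [0, -2, -4, 0],
   [0, 1, -2, -3],
   [0, 0, 2, 2],
   [0, 2, 4, 0],
   [0, 0, -1, 1],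
   [0, 0, 0, 0],
   [0, 0, 4, 2],
   [0, 0, -1, -2],
   [1, 1, 3, 4],
   [-1, -1, -3, 0],
   [0, 0, 0, 0],
   [0, 1, 4, -1],
   [0, 0, 0, 0],
   [-1, -1, -2, -1],
   [1, 1, 2, 0],
   [0, 0, 0, 0],
   [0, 0, 1, -1],
   [0, 0, 0, 2],
   [0, 0, 0, -1],
   [0, -1, 2, 3],
   [0, 0, 0, -2],
   [0, 0, -4, -2],
   [0, 0, 0, 0],
   [0, 0, 0, 1],
   [0, 0, -2, -2],
   [0, 0, 0, 1],
   [0, 0, 1, 2],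
   [0, 0, 0, -1],
   [0, 0, 0, 0]]

/-- The word of block indices attached to a lattice word. -/
def kap : List (Fin 3) → List ℕ
  | [] => []
  | x :: w => w.count x :: kap w

/-- The sign symbol. -/
def eps : List (Fin 3) → ℤ
  | [x, y, z] => ((y.val : ℤ) - x.val) * ((z.val : ℤ) - x.val) * ((z.val : ℤ) - y.val) / 2
  | _ => 0

def nel (x : Fin 3) : List (Fin 3) → Bool
  | [] => true
  | y :: l => if Nat.beq x.val y.val then false else nel x l

/-- Pruned step. -/
def psh (P Q R : List (Fin 3)) (k : ℕ) (x : Fin 3)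
    (G : List (Fin 3) → List (Fin 3) → List (Fin 3) → ℤ) : ℤ :=
  match k with
  | 0 => match nel x P with
    | true => G (P ++ [x]) Q R
    | false => 0
  | 1 => match nel x Q with
    | true => G P (Q ++ [x]) R
    | false => 0
  | _ => match nel x R with
    | true => G P Q (R ++ [x])
    | false => 0

/-- Efficient version. -/
def cd : List ℕ → List (Fin 3) → List (Fin 3) → List (Fin 3) → List (Fin 3) → List (Fin 3) → ℤ
  | [k], x :: _, _, P, Q, R => psh P Q R k x (fun P Q R => eps P * eps Q * eps R)
  | k :: κ, x :: fr, y :: bk, P, Q, R =>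
      psh P Q R k x (cd κ fr (y :: bk)) - psh P Q R k y (cd κ (x :: fr) bk)
  | _, _, _, _, _, _ => 0

section split
variable {R : Type*}

/-- Insert a letter in front of the `k`-th argument. -/
def ins (k : ℕ) (z : Fin 3) (G : List (Fin 3) → List (Fin 3) → List (Fin 3) → R) :
    List (Fin 3) → List (Fin 3) → List (Fin 3) → R :=
  match k with
  | 0 => fun p q r => G (z :: p) q r
  | 1 => fun p q r => G p (z :: q) r
  | _ => fun p q r => G p q (z :: r)

/-- Split a word in three blocks according to the block word. -/
def split [Zero R] : List ℕ → List (Fin 3) →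
    (List (Fin 3) → List (Fin 3) → List (Fin 3) → R) → R
  | [], [], G => G [] [] []
  | k :: κ, z :: w, G => split κ w (ins k z G)
  | [], _ :: _, _ => 0
  | _ :: _, [], _ => 0

end split

lemma ins_zero {R : Type*} [Zero R] (k : ℕ) (z : Fin 3) :
    ins k z (0 : List (Fin 3) → List (Fin 3) → List (Fin 3) → R) = 0 := by
  match k with
  | 0 => rfl
  | 1 => rfl
  | _ + 2 => rfl

lemma split_zero {R : Type*} [Zero R] (κ : List ℕ) : ∀ w,
    split κ w (0 : List (Fin 3) → List (Fin 3) → List (Fin 3) → R) = 0 := by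
  induction κ with
  | nil => intro w; cases w <;> rfl
  | cons k κ ih =>
    intro w
    cases w with
    | nil => rfl
    | cons z w => rw [split, ins_zero, ih]

lemma ins_add (k : ℕ) (z : Fin 3) (G H : List (Fin 3) → List (Fin 3) → List (Fin 3) → ℂ) :
    ins k z (G + H) = ins k z G + ins k z H := by
  match k with
  | 0 => rfl
  | 1 => rfl
  | _ + 2 => rfl

lemma ins_smul (k : ℕ) (z : Fin 3) (c : ℂ) (G : List (Fin 3) → List (Fin 3) → List (Fin 3) → ℂ) :
    ins k z (c • G) = c • ins k z G := by
  match k with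
  | 0 => rfl
  | 1 => rfl
  | _ + 2 => rfl

lemma split_add (κ : List ℕ) : ∀ w (G H : List (Fin 3) → List (Fin 3) → List (Fin 3) → ℂ),
    split κ w (G + H) = split κ w G + split κ w H := by
  induction κ with
  | nil => intro w; cases w <;> simp [split]
  | cons k κ ih =>
    intro w G H
    cases w with
    | nil => simp [split]
    | cons z w => rw [split, ins_add, ih]; rfl

lemma split_smul (κ : List ℕ) : ∀ w (c : ℂ) (G : List (Fin 3) → List (Fin 3) → List (Fin 3) → ℂ),
    split κ w (c • G) = c * split κ w G := by
  induction κ with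
  | nil => intro w; cases w <;> simp [split]
  | cons k κ ih =>
    intro w c G
    cases w with
    | nil => simp [split]
    | cons z w => rw [split, ins_smul, ih]; rfl

/-- Action on the three arguments. -/
def E3 (M : Fin 3 → Fin 3 → ℂ) (G : List (Fin 3) → List (Fin 3) → List (Fin 3) → ℂ) :
    List (Fin 3) → List (Fin 3) → List (Fin 3) → ℂ := fun p q r =>
  EM M (fun p => G p q r) p + EM M (fun q => G p q r) q + EM M (fun r => G p q r) r

lemma ins_E3 (M : Fin 3 → Fin 3 → ℂ) (k : ℕ) (z : Fin 3)
    (G : List (Fin 3) → List (Fin 3) → List (Fin 3) → ℂ) :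
    ins k z (E3 M G) = E3 M (ins k z G) + (M z 0 • ins k 0 G + M z 1 • ins k 1 G
      + M z 2 • ins k 2 G) := by
  have hs : ∀ (z : Fin 3) (f : WF), strip z f = fun v => f (z :: v) := fun _ _ => rfl
  match k with
  | 0 =>
    funext p q r
    simp only [ins, E3, EM_cons, Fin.sum_univ_three, Pi.add_apply, Pi.smul_apply, smul_eq_mul, hs]
    ring
  | 1 =>
    funext p q r
    simp only [ins, E3, EM_cons, Fin.sum_univ_three, Pi.add_apply, Pi.smul_apply, smul_eq_mul, hs]
    ring
  | _ + 2 =>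
    funext p q r
    simp only [ins, E3, EM_cons, Fin.sum_univ_three, Pi.add_apply, Pi.smul_apply, smul_eq_mul, hs]
    ring

lemma EM_split (M : Fin 3 → Fin 3 → ℂ) (κ : List ℕ) :
    ∀ (G : List (Fin 3) → List (Fin 3) → List (Fin 3) → ℂ) (w : List (Fin 3)),
    EM M (fun w => split κ w G) w = split κ w (E3 M G) := by
  induction κ with
  | nil =>
    intro G w
    cases w with
    | nil => simp [split, E3]
    | cons z w =>
      rw [EM_cons]
      have : strip z (fun w => split [] w G) = 0 := rfl
      rw [this]
      simp [split]
  | cons k κ ih =>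
    intro G w
    cases w with
    | nil => simp [split]
    | cons z w =>
      rw [EM_cons]
      have : strip z (fun w => split (k :: κ) w G) = fun w => split κ w (ins k z G) := rfl
      rw [this, ih]
      simp only [split]
      rw [ins_E3, split_add, split_add, split_add, split_smul, split_smul, split_smul,
        Fin.sum_univ_three]

/-- Complex sign symbol. -/
def epsC : WF := fun p => (eps p : ℂ)

lemma EM_eps (M : Fin 3 → Fin 3 → ℂ) (hM : M 0 0 + M 1 1 + M 2 2 = 0) (p : List (Fin 3)) :
    EM M epsC p = 0 := by
  have hd : M 2 2 = - M 0 0 - M 1 1 := by linear_combination hM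
  match p with
  | [] => rfl
  | [x] => simp [EM_cons, epsC, eps]
  | [x, y] => simp [EM_cons, epsC, eps]
  | [x, y, z] =>
    simp only [EM_cons, EM_nil, strip_apply, epsC, eps, Fin.sum_univ_three]
    have h3 : ∀ x : Fin 3, x = 0 ∨ x = 1 ∨ x = 2 := by decide
    rcases h3 x with rfl | rfl | rfl <;> rcases h3 y with rfl | rfl | rfl <;>
      rcases h3 z with rfl | rfl | rfl <;> norm_num [hd] <;> ring
  | x :: y :: z :: t :: l =>
    have h : ∀ (l : List (Fin 3)) (f : WF), (∀ l', l'.length = l.length → f l' = 0) →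
        EM M f l = 0 := by
      intro l
      induction l with
      | nil => intro f _; rfl
      | cons z l ih =>
        intro f hf
        rw [EM_cons, ih (strip z f) (fun l' h => hf (z :: l') (by simp [h]))]
        simp only [zero_add]
        exact Finset.sum_eq_zero fun y _ => by rw [hf _ (by simp), mul_zero]
    apply h
    intro l' hl'
    match l' with
    | x :: y :: z :: t :: l => simp [epsC, eps]

/-- The invariant tensors. -/
def T (κ : List ℕ) (w : List (Fin 3)) : ℤ := split κ w (fun p q r => eps p * eps q * eps r)

lemma split_cast (κ : List ℕ) : ∀ w (G : List (Fin 3) → List (Fin 3) → List (Fin 3) → ℤ),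
    ((split κ w G : ℤ) : ℂ) = split κ w (fun p q r => (G p q r : ℂ)) := by
  induction κ with
  | nil => intro w G; cases w <;> simp [split]
  | cons k κ ih =>
    intro w G
    cases w with
    | nil => simp [split]
    | cons z w =>
      rw [split, ih, split]
      match k with
      | 0 => rfl
      | 1 => rfl
      | _ + 2 => rfl

/-- The invariant tensors, complex version. -/
def TC (κ : List ℕ) : WF := fun w => (T κ w : ℂ)

lemma EM_TC (M : Fin 3 → Fin 3 → ℂ) (hM : M 0 0 + M 1 1 + M 2 2 = 0) (κ : List ℕ) :
    EM M (TC κ) = 0 := by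
  funext w
  have h1 : TC κ = fun w => split κ w (fun p q r => epsC p * epsC q * epsC r) := by
    funext w
    simp only [TC, T, split_cast]
    congr 1
    funext p q r
    simp [epsC]
  have h2 : E3 M (fun p q r => epsC p * epsC q * epsC r) = 0 := by
    funext p q r
    have e1 : (fun p => epsC p * epsC q * epsC r) = (epsC q * epsC r) • epsC := by
      funext p; simp; ring
    have e2 : (fun q => epsC p * epsC q * epsC r) = (epsC p * epsC r) • epsC := by
      funext p; simp; ring
    have e3 : (fun r => epsC p * epsC q * epsC r) = (epsC p * epsC q) • epsC := by
      funext p; simp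
    simp only [E3, e1, e2, e3, map_smul, Pi.smul_apply, EM_eps M hM]
    simp
  rw [h1, EM_split, h2, split_zero]
  rfl

lemma dyn_cast (n : ℕ) : ∀ (f : List (Fin 3) → ℤ) (w : List (Fin 3)),
    ((dyn n f w : ℤ) : ℂ) = dyn n (fun u => (f u : ℂ)) w := by
  induction n with
  | zero => intro f w; rfl
  | succ n ih =>
    intro f w
    match w with
    | [] => simp [dyn]
    | x :: v => simp only [dyn, Int.cast_sub, ih]

lemma dyn_zero (n : ℕ) : ∀ (w : List (Fin 3)), dyn n (fun _ => (0 : ℤ)) w = 0 := by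
  induction n with
  | zero => intro w; rfl
  | succ n ih =>
    intro w
    match w with
    | [] => simp [dyn]
    | x :: v => simp only [dyn, ih, sub_zero]

lemma eps_nodup (l : List (Fin 3)) (h : ¬ l.Nodup) : eps l = 0 := by
  match l with
  | [] => rfl
  | [x] => rfl
  | [x, y] => rfl
  | [x, y, z] => revert x y z; decide
  | x :: y :: z :: t :: l => rfl

/-- Partially filled blocks. -/
def GP (P Q R : List (Fin 3)) : List (Fin 3) → List (Fin 3) → List (Fin 3) → ℤ := fun p q r =>
  eps (P ++ p) * eps (Q ++ q) * eps (R ++ r)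

lemma nel_false (x : Fin 3) (P : List (Fin 3)) (h : nel x P = false) : x ∈ P := by
  induction P with
  | nil => simp [nel] at h
  | cons y l ih =>
    rw [nel] at h
    split at h
    · rename_i h1
      have := Fin.ext (Nat.eq_of_beq_eq_true h1)
      simp [this]
    · exact List.mem_cons_of_mem _ (ih h)

lemma eps_dup (x : Fin 3) (P p : List (Fin 3)) (h : nel x P = false) : eps (P ++ x :: p) = 0 := by
  apply eps_nodup
  intro hn
  have := List.disjoint_of_nodup_append hn (nel_false x P h)
  simp at this

lemma psh_eq (F : (List (Fin 3) → List (Fin 3) → List (Fin 3) → ℤ) → ℤ) (hF : F 0 = 0)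
    (G : List (Fin 3) → List (Fin 3) → List (Fin 3) → ℤ)
    (hG : ∀ P Q R, G P Q R = F (GP P Q R)) (P Q R : List (Fin 3)) (k : ℕ) (x : Fin 3) :
    psh P Q R k x G = F (ins k x (GP P Q R)) := by
  match k with
  | 0 =>
    simp only [psh, ins]
    split
    · rw [hG]; congr 1; funext p q r; simp [GP]
    · rename_i h
      rw [← hF]; congr 1; funext p q r; simp [GP, eps_dup _ _ _ h]
  | 1 =>
    simp only [psh, ins]
    split
    · rw [hG]; congr 1; funext p q r; simp [GP]
    · rename_i h
      rw [← hF]; congr 1; funext p q r; simp [GP, eps_dup _ _ _ h]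
  | _ + 2 =>
    simp only [psh, ins]
    split
    · rw [hG]; congr 1; funext p q r; simp [GP]
    · rename_i h
      rw [← hF]; congr 1; funext p q r; simp [GP, eps_dup _ _ _ h]

lemma cd_eq (n : ℕ) : ∀ (κ : List ℕ) (w fr bk P Q R : List (Fin 3)), κ.length = n + 1 →
    w.length = n + 1 → w = fr.take (n + 1) → w.reverse = bk.take (n + 1) →
    cd κ fr bk P Q R = dyn n (fun u => split κ u (GP P Q R)) w := by
  induction n with
  | zero =>
    intro κ w fr bk P Q R hκ hw hf hb
    obtain ⟨k, rfl⟩ := List.length_eq_one_iff.mp hκ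
    obtain ⟨x, rfl⟩ := List.length_eq_one_iff.mp hw
    match fr with
    | [] => simp at hf
    | x' :: fr =>
      simp at hf
      subst hf
      rw [cd, dyn]
      simp only [split]
      exact psh_eq (fun H => H [] [] []) rfl _ (fun P Q R => by simp [GP]) P Q R k x
  | succ n ih =>
    intro κ w fr bk P Q R hκ hw hf hb
    match κ, w, fr, bk with
    | k :: k' :: κ, x :: v, [], bk => simp at hf
    | k :: k' :: κ, x :: v, fr, [] => simp at hb
    | k :: k' :: κ, x :: v, x' :: fr, y :: bk =>
      simp only [List.take_succ_cons, List.cons.injEq] at hf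
      obtain ⟨rfl, hf⟩ := hf
      have hlast : (x :: v).getLast (by simp) = y := by
        have := congrArg List.head? hb
        rw [List.head?_reverse, List.getLast?_eq_some_getLast (by simp)] at this
        simpa using this
      have hdl : (x :: v).dropLast.reverse = bk.take (n + 1) := by
        rw [← List.tail_reverse, hb]; rfl
      simp only [List.length_cons, Nat.add_right_cancel_iff] at hκ hw
      have hF : ∀ w, (fun H => dyn n (fun u => split (k' :: κ) u H) w) 0 = (0 : ℤ) := by
        intro w
        simp only [split_zero, dyn_zero]
      rw [cd, dyn]
      · congr 1
        · refine psh_eq (fun H => dyn n (fun u => split (k' :: κ) u H) v) (hF v) _ ?_ P Q R k x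
          intro P Q R
          refine ih _ _ _ _ _ _ _ (by simpa using hκ) hw hf ?_
          have := congrArg (List.take (n + 1)) hb
          rw [List.take_take] at this
          rw [List.reverse_cons, List.take_append_of_le_length (by simp [hw]),
            List.take_of_length_le (by simp [hw])] at this
          simpa using this
        · rw [hlast]
          refine psh_eq (fun H => dyn n (fun u => split (k' :: κ) u H) _) (hF _) _ ?_ P Q R k y
          intro P Q R
          refine ih _ _ _ _ _ _ _ (by simpa using hκ) (by simp [hw]) ?_ hdl
          rw [List.dropLast_eq_take]
          simp [hf, List.take_take, hw ▸ congrArg List.length hf.symm]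
      all_goals simp

/-- The `i`-th lattice word. -/
def us (i : Fin 42) : List (Fin 3) := usL.getD i.val []

/-- The corresponding block word. -/
def kp (i : Fin 42) : List ℕ := kap (us i)

/-- Coordinates. -/
def Aij (i : Fin 42) (k : Fin 4) : ℤ := (AL.getD i.val []).getD k.val 0

/-- Values. -/
def Cjk (j : Fin 42) (k : Fin 4) : ℤ := (CL.getD j.val []).getD k.val 0

/-- Indices of the chosen basis. -/
def Sk : Fin 4 → Fin 42 := ![9, 15, 19, 25]

/-- Enumeration of lattice words. -/
def lats : ℕ → List (List (Fin 3))
  | 0 => [[]]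
  | n + 1 => (lats n).flatMap fun w => [0 :: w, 1 :: w, 2 :: w].filter lat

lemma mem_lats (w : List (Fin 3)) (h : lat w = true) : w ∈ lats w.length := by
  induction w with
  | nil => simp [lats]
  | cons z w ih =>
    have hw : lat w = true := by
      simp only [lat, Bool.and_eq_true] at h
      exact h.2
    simp only [List.length_cons, lats, List.mem_flatMap, List.mem_filter]
    refine ⟨w, ih hw, ?_, h⟩
    fin_cases z <;> simp

lemma lats_us : ∀ w ∈ lats 9, w.count 0 = 3 → w.count 1 = 3 → w.count 2 = 3 →
    w ∈ usL := by decide +kernel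

lemma us_of_lat (w : List (Fin 3)) (h : lat w = true) (h0 : w.count 0 = 3) (h1 : w.count 1 = 3)
    (h2 : w.count 2 = 3) : ∃ i, us i = w := by
  have hl : w.length = 9 := by rw [← length_count]; omega
  have := lats_us w (hl ▸ mem_lats w h) h0 h1 h2
  obtain ⟨i, hi, e⟩ := List.getElem_of_mem this
  exact ⟨⟨i, hi⟩, by simp only [us, List.getD_eq_getElem _ _ hi, e]⟩

lemma us_length (i : Fin 42) : (us i).length = 9 := by
  revert i; decide +kernel

lemma kp_length (i : Fin 42) : (kp i).length = 9 := by
  revert i; decide +kernel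

lemma T_tri : ∀ i j : Fin 42, i < j → T (kp i) (us j) = 0 := by decide +kernel

lemma T_diag : ∀ i : Fin 42, T (kp i) (us i) = -1 := by decide +kernel

lemma cd_table : ∀ i j : Fin 42, cd (kp i) (us j) (us j).reverse [] [] []
    = Aij i 0 * Cjk j 0 + Aij i 1 * Cjk j 1 + Aij i 2 * Cjk j 2 + Aij i 3 * Cjk j 3 := by
  decide +kernel

lemma A_unit : ∀ k l : Fin 4, Aij (Sk k) l = if k = l then 1 else 0 := by decide +kernel

lemma dyn_T (i j : Fin 42) : dyn 8 (T (kp i)) (us j) = ∑ k, Aij i k * Cjk j k := by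
  have h := cd_eq 8 (kp i) (us j) (us j) (us j).reverse [] [] [] (kp_length i) (us_length j)
    (by rw [List.take_of_length_le (by simp [us_length])])
    (by rw [List.take_of_length_le (by simp [us_length])])
  rw [cd_table] at h
  rw [Fin.sum_univ_four, h]
  rfl

lemma cf_Dy_TC (i j : Fin 42) :
    cf (Dy 9 (TC (kp i))) (us j) = ∑ k, (Aij i k : ℂ) * (Cjk j k : ℂ) := by
  rw [cf_Dy 8 _ _ (us_length j)]
  have := dyn_cast 8 (T (kp i)) (us j)
  rw [dyn_T] at this
  push_cast at this
  exact this.symm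

/-- Diagonal matrices. -/
def Dg (x y : Fin 3) : Fin 3 → Fin 3 → ℂ :=
  fun i j => if i = j then (if i = x then (1 : ℂ) else if i = y then -1 else 0) else 0

lemma EM_Dg (x y : Fin 3) (hxy : x ≠ y) (f : WF) (w : List (Fin 3)) :
    EM (Dg x y) f w = ((w.count x : ℂ) - w.count y) * f w := by
  unfold Dg
  rw [EM_diag, sum_diff x y hxy]

lemma supp_of (f : WF) (hl : ∀ w, w.length ≠ 9 → f w = 0) (h1 : EM (Dg 0 1) f = 0)
    (h2 : EM (Dg 1 2) f = 0) (w : List (Fin 3)) (hw : f w ≠ 0) :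
    w.count 0 = 3 ∧ w.count 1 = 3 ∧ w.count 2 = 3 := by
  have e1 := congrFun h1 w
  have e2 := congrFun h2 w
  rw [EM_Dg _ _ (by decide)] at e1 e2
  have e1 := (mul_eq_zero.mp e1).resolve_right hw
  have e2 := (mul_eq_zero.mp e2).resolve_right hw
  rw [sub_eq_zero] at e1 e2
  have e1 := Nat.cast_injective e1
  have e2 := Nat.cast_injective e2
  have e3 := length_count w
  have e4 : w.length = 9 := by
    by_contra h
    exact hw (hl w h)
  omega

lemma invt_zero (f : WF) (hl : ∀ w, w.length ≠ 9 → f w = 0) (h1 : EM (Dg 0 1) f = 0)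
    (h2 : EM (Dg 1 2) f = 0) (h3 : EM (U 0 1) f = 0) (h4 : EM (U 1 2) f = 0)
    (hu : ∀ j, f (us j) = 0) : f = 0 := by
  refine hw_zero 9 f 3 3 3 rfl (supp_of f hl h1 h2) h3 h4 ?_
  intro w hw
  by_contra h
  obtain ⟨a, b, c⟩ := supp_of f hl h1 h2 w h
  obtain ⟨i, rfl⟩ := us_of_lat w hw a b c
  exact h (hu i)

lemma split_length {R : Type*} [Zero R] (κ : List ℕ) : ∀ w
    (G : List (Fin 3) → List (Fin 3) → List (Fin 3) → R), w.length ≠ κ.length →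
    split κ w G = 0 := by
  induction κ with
  | nil => intro w G h; cases w <;> simp_all [split]
  | cons k κ ih =>
    intro w G h
    cases w with
    | nil => rfl
    | cons z w =>
      rw [split]
      exact ih _ _ (by simpa using h)

lemma TC_length (i : Fin 42) (w : List (Fin 3)) (hw : w.length ≠ 9) : TC (kp i) w = 0 := by
  simp only [TC, T]
  rw [split_length _ _ _ (by rw [kp_length]; exact hw)]
  simp

lemma U_tr (x y : Fin 3) (h : x ≠ y) : U x y 0 0 + U x y 1 1 + U x y 2 2 = 0 := by
  revert h; fin_cases x <;> fin_cases y <;> simp [U]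

lemma Dg_tr (x y : Fin 3) (h : x ≠ y) : Dg x y 0 0 + Dg x y 1 1 + Dg x y 2 2 = 0 := by
  revert h; fin_cases x <;> fin_cases y <;> simp [Dg]

lemma tri_solve (v : Fin 42 → ℂ) : ∃ g : Fin 42 → ℂ, ∀ j, ∑ i, g i * TC (kp i) (us j) = v j := by
  let M : Matrix (Fin 42) (Fin 42) ℂ := fun i j => TC (kp i) (us j)
  have hdet : IsUnit M.det := by
    rw [Matrix.det_of_isLowerTriangular]
    · rw [isUnit_iff_ne_zero, Finset.prod_ne_zero_iff]
      intro i _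
      simp [M, TC, T_diag]
    · intro i j hij
      simp only [M, TC, T_tri i j hij, Int.cast_zero]
  refine ⟨Matrix.vecMul v M⁻¹, fun j => ?_⟩
  have : Matrix.vecMul (Matrix.vecMul v M⁻¹) M = v := by
    rw [Matrix.vecMul_vecMul, Matrix.nonsing_inv_mul _ hdet, Matrix.vecMul_one]
  exact congrFun this j

lemma inv_span (f : WF) (hl : ∀ w, w.length ≠ 9 → f w = 0) (h1 : EM (Dg 0 1) f = 0)
    (h2 : EM (Dg 1 2) f = 0) (h3 : EM (U 0 1) f = 0) (h4 : EM (U 1 2) f = 0) :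
    ∃ g : Fin 42 → ℂ, f = ∑ i, g i • TC (kp i) := by
  obtain ⟨g, hg⟩ := tri_solve (fun j => f (us j))
  refine ⟨g, ?_⟩
  rw [← sub_eq_zero]
  apply invt_zero
  · intro w hw
    simp [hl w hw, TC_length _ w hw]
  · simp [h1, EM_TC _ (Dg_tr 0 1 (by decide))]
  · simp [h2, EM_TC _ (Dg_tr 1 2 (by decide))]
  · simp [h3, EM_TC _ (U_tr 0 1 (by decide))]
  · simp [h4, EM_TC _ (U_tr 1 2 (by decide))]
  · intro j
    have := hg j
    simp [← this]

/-- The basis of invariants. -/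
def Wb (k : Fin 4) : FL := Dy 9 (TC (kp (Sk k)))

lemma cf_Wb (k : Fin 4) (j : Fin 42) : cf (Wb k) (us j) = (Cjk j k : ℂ) := by
  rw [Wb, cf_Dy_TC]
  simp [A_unit]

lemma Wb_indep : LinearIndependent ℂ Wb := by
  rw [Fintype.linearIndependent_iff]
  intro g hg
  have e : ∀ j : Fin 42, ∑ k, g k * (Cjk j k : ℂ) = 0 := by
    intro j
    have := congrFun (congrArg cf hg) (us j)
    simpa [cf_Wb] using this
  have e1 := e 1
  have e2 := e 2
  have e3 := e 3
  have e7 := e 7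
  have c1 : ∀ k, Cjk 1 k = ![0, 2, 6, 4] k := by decide +kernel
  have c2 : ∀ k, Cjk 2 k = ![-1, -1, -3, -4] k := by decide +kernel
  have c3 : ∀ k, Cjk 3 k = ![-1, -3, -7, -2] k := by decide +kernel
  have c7 : ∀ k, Cjk 7 k = ![1, 1, 3, 0] k := by decide +kernel
  simp only [c1, c2, c3, c7, Fin.sum_univ_four] at e1 e2 e3 e7
  simp at e1 e2 e3 e7
  have g3 : g 3 = 0 := by linear_combination (-1 / 4 : ℂ) * (e2 + e7)
  have g0 : g 0 = 0 := by linear_combination e7 - (1 / 2 : ℂ) * e1 + 2 * g3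
  have g2 : g 2 = 0 := by
    linear_combination (1 / 2 : ℂ) * (e3 + (3 / 2 : ℂ) * e1 + g0 - 4 * g3)
  have g1 : g 1 = 0 := by linear_combination e7 - g0 - 3 * g2
  intro i
  fin_cases i <;> assumption

lemma smul_nine_zero (D : FL) (hD : D ∈ homog 9) (h : cf D = 0) : D = 0 := by
  have := Dy_cf 9 D hD
  rw [h, map_zero] at this
  rcases smul_eq_zero.mp this.symm with h | h
  · norm_num at h
  · exact h

lemma kill_Dy_TC (X : LieDerivation ℂ FL FL) (M : Fin 3 → Fin 3 → ℂ)
    (hX : ∀ x, X (FreeLieAlgebra.of ℂ x) = ∑ y, M y x • FreeLieAlgebra.of ℂ y)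
    (hM : M 0 0 + M 1 1 + M 2 2 = 0) (κ : List ℕ) : X (Dy 9 (TC κ)) = 0 := by
  rw [deriv_Dy X M hX 8, EM_TC M hM, map_zero]

lemma EM_cf_zero (X : LieDerivation ℂ FL FL) (M : Fin 3 → Fin 3 → ℂ)
    (hX : ∀ x, X (FreeLieAlgebra.of ℂ x) = ∑ y, M y x • FreeLieAlgebra.of ℂ y)
    (Z : FL) (h : X Z = 0) : EM M (cf Z) = 0 := by
  rw [← cf_deriv X M hX, h, map_zero]

lemma Dy9_mem (f : WF) : Dy 9 f ∈ homog 9 := Dy_mem 8 f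

lemma invt_FL (X1 X2 H1 H2 : LieDerivation ℂ FL FL)
    (hX1 : ∀ x, X1 (FreeLieAlgebra.of ℂ x) = ∑ y, U 0 1 y x • FreeLieAlgebra.of ℂ y)
    (hX2 : ∀ x, X2 (FreeLieAlgebra.of ℂ x) = ∑ y, U 1 2 y x • FreeLieAlgebra.of ℂ y)
    (hH1 : ∀ x, H1 (FreeLieAlgebra.of ℂ x) = ∑ y, Dg 0 1 y x • FreeLieAlgebra.of ℂ y)
    (hH2 : ∀ x, H2 (FreeLieAlgebra.of ℂ x) = ∑ y, Dg 1 2 y x • FreeLieAlgebra.of ℂ y)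
    (D : FL) (hD : D ∈ homog 9) (h1 : X1 D = 0) (h2 : X2 D = 0) (h3 : H1 D = 0)
    (h4 : H2 D = 0) (hu : ∀ j, cf D (us j) = 0) : D = 0 := by
  apply smul_nine_zero _ hD
  exact invt_zero (cf D) (cf_length 9 D hD) (EM_cf_zero H1 _ hH1 D h3)
    (EM_cf_zero H2 _ hH2 D h4) (EM_cf_zero X1 _ hX1 D h1) (EM_cf_zero X2 _ hX2 D h2) hu

lemma kill_diff (X : LieDerivation ℂ FL FL) (Z : FL) (a : Fin 4 → ℂ) (W : Fin 4 → FL)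
    (hZ : X Z = 0) (hW : ∀ k, X (W k) = 0) : X (Z - ∑ k, a k • W k) = 0 := by
  rw [map_sub, map_sum, hZ]
  simp [hW]

lemma Dy_rel (X1 X2 H1 H2 : LieDerivation ℂ FL FL)
    (hX1 : ∀ x, X1 (FreeLieAlgebra.of ℂ x) = ∑ y, U 0 1 y x • FreeLieAlgebra.of ℂ y)
    (hX2 : ∀ x, X2 (FreeLieAlgebra.of ℂ x) = ∑ y, U 1 2 y x • FreeLieAlgebra.of ℂ y)
    (hH1 : ∀ x, H1 (FreeLieAlgebra.of ℂ x) = ∑ y, Dg 0 1 y x • FreeLieAlgebra.of ℂ y)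
    (hH2 : ∀ x, H2 (FreeLieAlgebra.of ℂ x) = ∑ y, Dg 1 2 y x • FreeLieAlgebra.of ℂ y)
    (i : Fin 42) : Dy 9 (TC (kp i)) = ∑ k, (Aij i k : ℂ) • Wb k := by
  rw [← sub_eq_zero]
  apply invt_FL X1 X2 H1 H2 hX1 hX2 hH1 hH2
  · exact Submodule.sub_mem _ (Dy9_mem _)
      (Submodule.sum_mem _ fun k _ => Submodule.smul_mem _ _ (Dy9_mem _))
  · exact kill_diff X1 _ _ _ (kill_Dy_TC X1 _ hX1 (U_tr 0 1 (by decide)) _)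
      (fun k => kill_Dy_TC X1 _ hX1 (U_tr 0 1 (by decide)) _)
  · exact kill_diff X2 _ _ _ (kill_Dy_TC X2 _ hX2 (U_tr 1 2 (by decide)) _)
      (fun k => kill_Dy_TC X2 _ hX2 (U_tr 1 2 (by decide)) _)
  · exact kill_diff H1 _ _ _ (kill_Dy_TC H1 _ hH1 (Dg_tr 0 1 (by decide)) _)
      (fun k => kill_Dy_TC H1 _ hH1 (Dg_tr 0 1 (by decide)) _)
  · exact kill_diff H2 _ _ _ (kill_Dy_TC H2 _ hH2 (Dg_tr 1 2 (by decide)) _)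
      (fun k => kill_Dy_TC H2 _ hH2 (Dg_tr 1 2 (by decide)) _)
  · intro j
    rw [map_sub, map_sum, Pi.sub_apply, cf_Dy_TC, Finset.sum_apply, sub_eq_zero]
    refine Finset.sum_congr rfl fun k _ => ?_
    rw [map_smul, Pi.smul_apply, cf_Wb, smul_eq_mul]

lemma inv_mem_span (X1 X2 H1 H2 : LieDerivation ℂ FL FL)
    (hX1 : ∀ x, X1 (FreeLieAlgebra.of ℂ x) = ∑ y, U 0 1 y x • FreeLieAlgebra.of ℂ y)
    (hX2 : ∀ x, X2 (FreeLieAlgebra.of ℂ x) = ∑ y, U 1 2 y x • FreeLieAlgebra.of ℂ y)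
    (hH1 : ∀ x, H1 (FreeLieAlgebra.of ℂ x) = ∑ y, Dg 0 1 y x • FreeLieAlgebra.of ℂ y)
    (hH2 : ∀ x, H2 (FreeLieAlgebra.of ℂ x) = ∑ y, Dg 1 2 y x • FreeLieAlgebra.of ℂ y)
    (Z : FL) (hZ : Z ∈ homog 9) (h1 : X1 Z = 0) (h2 : X2 Z = 0) (h3 : H1 Z = 0)
    (h4 : H2 Z = 0) : Z ∈ Submodule.span ℂ (Set.range Wb) := by
  obtain ⟨g, hg⟩ := inv_span (cf Z) (cf_length 9 Z hZ) (EM_cf_zero H1 _ hH1 Z h3)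
    (EM_cf_zero H2 _ hH2 Z h4) (EM_cf_zero X1 _ hX1 Z h1) (EM_cf_zero X2 _ hX2 Z h2)
  have h := Dy_cf 9 Z hZ
  rw [hg, map_sum] at h
  have h9 : ((9 : ℕ) : ℂ) • Z ∈ Submodule.span ℂ (Set.range Wb) := by
    rw [← h]
    refine Submodule.sum_mem _ fun i _ => ?_
    rw [map_smul, Dy_rel X1 X2 H1 H2 hX1 hX2 hH1 hH2]
    refine Submodule.smul_mem _ _ (Submodule.sum_mem _ fun k _ => Submodule.smul_mem _ _ ?_)
    exact Submodule.subset_span ⟨k, rfl⟩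
  exact (Submodule.smul_mem_iff _ (by norm_num)).mp h9

/-- `[[a,b],[a,c]]` -/
def pp : FL := ⁅⁅genA, genB⁆, ⁅genA, genC⁆⁆
/-- `[[a,b],[b,c]]` -/
def qq : FL := ⁅⁅genA, genB⁆, ⁅genB, genC⁆⁆
/-- `[[a,c],[b,c]]` -/
def rr : FL := ⁅⁅genA, genC⁆, ⁅genB, genC⁆⁆

lemma wever_eq : wever = ⁅⁅pp, qq⁆, genC⁆ + ⁅⁅qq, rr⁆, genA⁆ + ⁅⁅rr, pp⁆, genB⁆ := by
  have hba : ba = - ab := by rw [ba, ab, lie_skew]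
  have hca : ca = - ac := by rw [ca, ac, lie_skew]
  have hcb : cb = - bc := by rw [cb, bc, lie_skew]
  have h1 : ⁅bc, ba⁆ = qq := by rw [hba, lie_neg, lie_skew]; rfl
  have h2 : ⁅bc, ca⁆ = rr := by rw [hca, lie_neg, lie_skew]; rfl
  have h3 : ⁅ca, cb⁆ = rr := by rw [hca, hcb, lie_neg, neg_lie, neg_neg]; rfl
  have h4 : ⁅ca, ab⁆ = pp := by rw [hca, neg_lie, lie_skew]; rfl
  rw [wever, h1, h2, h3, h4]
  rfl

lemma wever_mem : wever ∈ homog 9 := by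
  refine Submodule.add_mem _ (Submodule.add_mem _ ?_ ?_) ?_
  · let a : FreeMagma (Fin 3) := .of 0
    let b : FreeMagma (Fin 3) := .of 1
    let c : FreeMagma (Fin 3) := .of 2
    exact Submodule.subset_span ⟨(((a * b) * (a * c)) * ((a * b) * (b * c))) * c, rfl, rfl⟩
  · let a : FreeMagma (Fin 3) := .of 0
    let b : FreeMagma (Fin 3) := .of 1
    let c : FreeMagma (Fin 3) := .of 2
    exact Submodule.subset_span ⟨(((b * c) * (b * a)) * ((b * c) * (c * a))) * a, rfl, rfl⟩
  · let a : FreeMagma (Fin 3) := .of 0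
    let b : FreeMagma (Fin 3) := .of 1
    let c : FreeMagma (Fin 3) := .of 2
    exact Submodule.subset_span ⟨(((c * a) * (c * b)) * ((c * a) * (a * b))) * b, rfl, rfl⟩

/-- Derivation rule for `wever` in terms of the values on `pp`, `qq`, `rr`. -/
lemma X_wever (X : LieDerivation ℂ FL FL) (α β γ δ ε ζ η θ ι : ℂ)
    (hA : X genA = α • genA + β • genB + γ • genC)
    (hB : X genB = δ • genA + ε • genB + ζ • genC)
    (hC : X genC = η • genA + θ • genB + ι • genC)
    (hq : α + ε + ι = 0) : X wever = 0 := by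
  have s1 : ⁅genB, genA⁆ = -⁅genA, genB⁆ := (lie_skew _ _).symm
  have s2 : ⁅genC, genA⁆ = -⁅genA, genC⁆ := (lie_skew _ _).symm
  have s3 : ⁅genC, genB⁆ = -⁅genB, genC⁆ := (lie_skew _ _).symm
  have t1 : ⁅⁅genA, genC⁆, ⁅genA, genB⁆⁆ = -pp := (lie_skew _ _).symm
  have t2 : ⁅⁅genB, genC⁆, ⁅genA, genB⁆⁆ = -qq := (lie_skew _ _).symm
  have t3 : ⁅⁅genB, genC⁆, ⁅genA, genC⁆⁆ = -rr := (lie_skew _ _).symm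
  have t4 : ⁅⁅genA, genB⁆, ⁅genA, genC⁆⁆ = pp := rfl
  have t5 : ⁅⁅genA, genB⁆, ⁅genB, genC⁆⁆ = qq := rfl
  have t6 : ⁅⁅genA, genC⁆, ⁅genB, genC⁆⁆ = rr := rfl
  have u1 : ⁅qq, pp⁆ = -⁅pp, qq⁆ := (lie_skew _ _).symm
  have u2 : ⁅rr, pp⁆ = -⁅pp, rr⁆ := (lie_skew _ _).symm
  have u3 : ⁅rr, qq⁆ = -⁅qq, rr⁆ := (lie_skew _ _).symm
  have hab : X ⁅genA, genB⁆ = (α + ε) • ⁅genA, genB⁆ + ζ • ⁅genA, genC⁆ - γ • ⁅genB, genC⁆ := by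
    rw [LieDerivation.apply_lie_eq_add, hA, hB]
    simp only [lie_add, add_lie, lie_smul, smul_lie, lie_self, s1, s2, s3]
    module
  have hac : X ⁅genA, genC⁆ = θ • ⁅genA, genB⁆ + (α + ι) • ⁅genA, genC⁆ + β • ⁅genB, genC⁆ := by
    rw [LieDerivation.apply_lie_eq_add, hA, hC]
    simp only [lie_add, add_lie, lie_smul, smul_lie, lie_self, s1, s2, s3]
    module
  have hbc : X ⁅genB, genC⁆ = -η • ⁅genA, genB⁆ + δ • ⁅genA, genC⁆ + (ε + ι) • ⁅genB, genC⁆ := by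
    rw [LieDerivation.apply_lie_eq_add, hB, hC]
    simp only [lie_add, add_lie, lie_smul, smul_lie, lie_self, s1, s2, s3]
    module
  have hp : X pp = (α + ε + α + ι) • pp + β • qq + γ • rr := by
    rw [pp, LieDerivation.apply_lie_eq_add, hab, hac]
    simp only [lie_add, add_lie, lie_sub, sub_lie, lie_smul, smul_lie, lie_self, t1, t2, t3]
    simp only [t4, t5, t6]
    module
  have hqq : X qq = δ • pp + (α + ε + ε + ι) • qq + ζ • rr := by
    rw [qq, LieDerivation.apply_lie_eq_add, hab, hbc]
    simp only [lie_add, add_lie, lie_sub, sub_lie, lie_smul, smul_lie, lie_self, t1, t2, t3]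
    simp only [t4, t5, t6]
    module
  have hr : X rr = η • pp + θ • qq + (α + ι + ε + ι) • rr := by
    rw [rr, LieDerivation.apply_lie_eq_add, hac, hbc]
    simp only [lie_add, add_lie, lie_sub, sub_lie, lie_smul, smul_lie, lie_self, t1, t2, t3]
    simp only [t4, t5, t6]
    module
  have hι : ι = -α - ε := by linear_combination hq
  rw [wever_eq, map_add, map_add]
  simp only [LieDerivation.apply_lie_eq_add, hp, hqq, hr, hA, hB, hC]
  simp only [lie_add, add_lie, lie_smul, smul_lie, lie_self, u1, u2, u3, neg_lie, lie_neg, hι]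
  simp only [zero_lie]
  module

lemma wever_ne : wever ≠ 0 := by
  let φ : FL →ₗ⁅ℂ⁆ Matrix (Fin 3) (Fin 3) ℂ := FreeLieAlgebra.lift ℂ
    ![!![0, 0, 0; 0, 0, -1; 0, 0, 0], !![0, -1, 0; 0, 0, 0; 0, 0, -1],
      !![0, 0, 0; 0, 0, 0; 0, -1, 0]]
  intro h
  have h := congrArg φ h
  have hA : φ genA = !![0, 0, 0; 0, 0, -1; 0, 0, 0] := by simp [φ, genA]
  have hB : φ genB = !![0, -1, 0; 0, 0, 0; 0, 0, -1] := by simp [φ, genB]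
  have hC : φ genC = !![0, 0, 0; 0, 0, 0; 0, -1, 0] := by simp [φ, genC]
  have hab : φ ⁅genA, genB⁆ = !![0, 0, -1; 0, 0, 1; 0, 0, 0] := by
    rw [LieHom.map_lie, hA, hB, Ring.lie_def]
    ext i j; fin_cases i <;> fin_cases j <;> simp
  have hac : φ ⁅genA, genC⁆ = !![0, 0, 0; 0, 1, 0; 0, 0, -1] := by
    rw [LieHom.map_lie, hA, hC, Ring.lie_def]
    ext i j; fin_cases i <;> fin_cases j <;> simp
  have hbc : φ ⁅genB, genC⁆ = !![0, 0, 0; 0, 0, 0; 0, 1, 0] := by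
    rw [LieHom.map_lie, hB, hC, Ring.lie_def]
    ext i j; fin_cases i <;> fin_cases j <;> simp
  have hp : φ pp = !![0, 0, 1; 0, 0, -2; 0, 0, 0] := by
    rw [pp, LieHom.map_lie, hab, hac, Ring.lie_def]
    ext i j; fin_cases i <;> fin_cases j <;> norm_num
  have hq : φ qq = !![0, -1, 0; 0, 1, 0; 0, 0, -1] := by
    rw [qq, LieHom.map_lie, hab, hbc, Ring.lie_def]
    ext i j; fin_cases i <;> fin_cases j <;> norm_num
  have hr : φ rr = !![0, 0, 0; 0, 0, 0; 0, -2, 0] := by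
    rw [rr, LieHom.map_lie, hac, hbc, Ring.lie_def]
    ext i j; fin_cases i <;> fin_cases j <;> norm_num
  rw [wever_eq, map_add, map_add, map_zero] at h
  simp only [LieHom.map_lie, hp, hq, hr, hA, hB, hC, Ring.lie_def] at h
  have h := congrFun (congrFun h 0) 1
  norm_num [Matrix.mul_apply, Fin.sum_univ_three] at h

/-- For the natural representation of sl₃(ℂ) on the free Lie algebra on `a, b, c`, the
space of Lie invariants of degree 9 has dimension 4; in particular Wever's element is
a nonzero Lie invariant of degree 9. -/
theorem sl3_invariants_degree_nine
    (X1 X2 X3 H1 H2 Y1 Y2 Y3 : LieDerivation ℂ FL FL)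
    (hX1a : X1 genA = 0) (hX1b : X1 genB = genA) (hX1c : X1 genC = 0)
    (hX2a : X2 genA = 0) (hX2b : X2 genB = 0) (hX2c : X2 genC = genB)
    (hX3a : X3 genA = 0) (hX3b : X3 genB = 0) (hX3c : X3 genC = genA)
    (hH1a : H1 genA = genA) (hH1b : H1 genB = -genB) (hH1c : H1 genC = 0)
    (hH2a : H2 genA = 0) (hH2b : H2 genB = genB) (hH2c : H2 genC = -genC)
    (hY1a : Y1 genA = genB) (hY1b : Y1 genB = 0) (hY1c : Y1 genC = 0)
    (hY2a : Y2 genA = 0) (hY2b : Y2 genB = genC) (hY2c : Y2 genC = 0)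
    (hY3a : Y3 genA = genC) (hY3b : Y3 genB = 0) (hY3c : Y3 genC = 0) :
    Module.rank ℂ ↥(invariants3 X1 X2 X3 H1 H2 Y1 Y2 Y3 9) = 4 ∧
    wever ∈ invariants3 X1 X2 X3 H1 H2 Y1 Y2 Y3 9 ∧ wever ≠ (0 : FL) := by
  have hU : ∀ (X : LieDerivation ℂ FL FL) (M : Fin 3 → Fin 3 → ℂ),
      X genA = M 0 0 • genA + M 1 0 • genB + M 2 0 • genC →
      X genB = M 0 1 • genA + M 1 1 • genB + M 2 1 • genC →
      X genC = M 0 2 • genA + M 1 2 • genB + M 2 2 • genC →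
      ∀ x, X (FreeLieAlgebra.of ℂ x) = ∑ y, M y x • FreeLieAlgebra.of ℂ y := by
    intro X M hA hB hC x
    rw [Fin.sum_univ_three]
    fin_cases x
    · exact hA
    · exact hB
    · exact hC
  have eX1 := hU X1 (U 0 1) (by simp [U, hX1a]) (by simp [U, hX1b]) (by simp [U, hX1c])
  have eX2 := hU X2 (U 1 2) (by simp [U, hX2a]) (by simp [U, hX2b]) (by simp [U, hX2c])
  have eX3 := hU X3 (U 0 2) (by simp [U, hX3a]) (by simp [U, hX3b]) (by simp [U, hX3c])
  have eH1 := hU H1 (Dg 0 1) (by simp [Dg, hH1a]) (by simp [Dg, hH1b]) (by simp [Dg, hH1c])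
  have eH2 := hU H2 (Dg 1 2) (by simp [Dg, hH2a]) (by simp [Dg, hH2b]) (by simp [Dg, hH2c])
  have eY1 := hU Y1 (U 1 0) (by simp [U, hY1a]) (by simp [U, hY1b]) (by simp [U, hY1c])
  have eY2 := hU Y2 (U 2 1) (by simp [U, hY2a]) (by simp [U, hY2b]) (by simp [U, hY2c])
  have eY3 := hU Y3 (U 2 0) (by simp [U, hY3a]) (by simp [U, hY3b]) (by simp [U, hY3c])
  have mem : ∀ Z : FL, Z ∈ invariants3 X1 X2 X3 H1 H2 Y1 Y2 Y3 9 ↔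
      (((((((Z ∈ homog 9 ∧ X1 Z = 0) ∧ X2 Z = 0) ∧ X3 Z = 0) ∧ H1 Z = 0) ∧ H2 Z = 0) ∧
        Y1 Z = 0) ∧ Y2 Z = 0) ∧ Y3 Z = 0 := fun Z => Iff.rfl
  have wk : ∀ (X : LieDerivation ℂ FL FL) (M : Fin 3 → Fin 3 → ℂ),
      (∀ x, X (FreeLieAlgebra.of ℂ x) = ∑ y, M y x • FreeLieAlgebra.of ℂ y) →
      M 0 0 + M 1 1 + M 2 2 = 0 → X wever = 0 := by
    intro X M hX hM
    have h0 := hX 0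
    have h1 := hX 1
    have h2 := hX 2
    rw [Fin.sum_univ_three] at h0 h1 h2
    exact X_wever X _ _ _ _ _ _ _ _ _ h0 h1 h2 hM
  refine ⟨?_, ?_, wever_ne⟩
  · have hspan : invariants3 X1 X2 X3 H1 H2 Y1 Y2 Y3 9 = Submodule.span ℂ (Set.range Wb) := by
      apply le_antisymm
      · intro Z hZ
        obtain ⟨⟨⟨⟨⟨⟨⟨⟨h, h1⟩, h2⟩, -⟩, h3⟩, h4⟩, -⟩, -⟩, -⟩ := (mem Z).mp hZ
        exact inv_mem_span X1 X2 H1 H2 eX1 eX2 eH1 eH2 Z h h1 h2 h3 h4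
      · rw [Submodule.span_le]
        rintro _ ⟨k, rfl⟩
        refine (mem _).mpr ⟨⟨⟨⟨⟨⟨⟨⟨Dy9_mem _, ?_⟩, ?_⟩, ?_⟩, ?_⟩, ?_⟩, ?_⟩, ?_⟩, ?_⟩
        · exact kill_Dy_TC X1 _ eX1 (U_tr _ _ (by decide)) _
        · exact kill_Dy_TC X2 _ eX2 (U_tr _ _ (by decide)) _
        · exact kill_Dy_TC X3 _ eX3 (U_tr _ _ (by decide)) _
        · exact kill_Dy_TC H1 _ eH1 (Dg_tr _ _ (by decide)) _
        · exact kill_Dy_TC H2 _ eH2 (Dg_tr _ _ (by decide)) _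
        · exact kill_Dy_TC Y1 _ eY1 (U_tr _ _ (by decide)) _
        · exact kill_Dy_TC Y2 _ eY2 (U_tr _ _ (by decide)) _
        · exact kill_Dy_TC Y3 _ eY3 (U_tr _ _ (by decide)) _
    rw [hspan, rank_span Wb_indep, Cardinal.mk_range_eq _ Wb_indep.injective]
    simp
  · refine (mem _).mpr ⟨⟨⟨⟨⟨⟨⟨⟨wever_mem, ?_⟩, ?_⟩, ?_⟩, ?_⟩, ?_⟩, ?_⟩, ?_⟩, ?_⟩
    · exact wk X1 _ eX1 (U_tr _ _ (by decide))
    · exact wk X2 _ eX2 (U_tr _ _ (by decide))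
    · exact wk X3 _ eX3 (U_tr _ _ (by decide))
    · exact wk H1 _ eH1 (Dg_tr _ _ (by decide))
    · exact wk H2 _ eH2 (Dg_tr _ _ (by decide))
    · exact wk Y1 _ eY1 (U_tr _ _ (by decide))
    · exact wk Y2 _ eY2 (U_tr _ _ (by decide))
    · exact wk Y3 _ eY3 (U_tr _ _ (by decide))
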